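/- Suppose 1 ≤ s ≤ r. Let λ' be an integer with λ'·λ_{j_s} ≡ 1 (mod m), let (a_0, …, a_{s−1}) be an arithmetic pure gap at (j_0, …, j_{s−1}) with 1 ≤ a_i ≤ m−1 for all 0 ≤ i ≤ s−1, and let a be an integer with 1 ≤ a ≤ m−1. Assume that ∑_{i=0}^{s−1} ⌊(a_i − a·λ'·λ_{j_i})/m⌋ + ⌊(a − a·λ'·λ_{j_s})/m⌋ + ∑_{i=s+1}^{r} ⌊(−a·λ'·λ_{j_i})/m⌋ ≤ −1. Then (a_0, …, a_{s−1}, a) is an arithmetic pure gap at (j_0, …, j_{s−1}, j_s) if and only if for every integer k with 1 ≤ k ≤ a−1 at least one of the following holds: (1) ∑_{i=0}^{s−1} ⌊(a_i − k·λ'·λ_{j_i})/m⌋ + ⌊(a − k·λ'·λ_{j_s})/m⌋ + ∑_{i=s+1}^{r} ⌊(−k·λ'·λ_{j_i})/m⌋ ≤ −1; (2) a_i ≢ k·λ'·λ_{j_i} (mod m) for all 0 ≤ i ≤ s−1. -/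

import Mathlib

open Finset

/-- Floor of the rational number `x / m`. -/
noncomputable def fdivq (m : ℕ) (x : ℤ) : ℤ := ⌊(x : ℚ) / (m : ℚ)⌋

/-- The quantity `∑_{i=0}^{n-1} ⌊(a_i + t·λ_{c i})/m⌋ + ∑_{w ∉ range c} ⌊t·λ_w/m⌋`. -/
noncomputable def gapSum (m r n : ℕ) (lam : Fin (r + 1) → ℤ)
    (c : Fin n → Fin (r + 1)) (a : Fin n → ℤ) (t : ℤ) : ℤ :=
  (∑ i : Fin n, fdivq m (a i + t * lam (c i))) +
    ∑ w ∈ Finset.univ \ Finset.image c Finset.univ, fdivq m (t * lam w)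

/-- `(a 0, …, a (n-1))` is an *arithmetic pure gap* at the (pairwise distinct) indices
`c 0, …, c (n-1)` of `{0,…,r}`: the entries are nonnegative and for every
`t ∈ {0,…,m-1}` exactly one of the two Bartoli–Quoos–Zini conditions holds. -/
noncomputable def IsArithPureGap (m r n : ℕ) (lam : Fin (r + 1) → ℤ)
    (c : Fin n → Fin (r + 1)) (a : Fin n → ℤ) : Prop :=
  (∀ i, 0 ≤ a i) ∧
    ∀ t : ℤ, 0 ≤ t → t ≤ (m : ℤ) - 1 →
      Xor' (gapSum m r n lam c a t < 0)
        (0 ≤ gapSum m r n lam c a t ∧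
          ∀ i : Fin n, fdivq m (a i + t * lam (c i)) = fdivq m (a i + t * lam (c i) - 1))

theorem fdivq_eq_ediv (m : ℕ) (x : ℤ) : fdivq m x = x / (m : ℤ) := by
  simpa [fdivq] using Rat.floor_intCast_div_natCast x m

theorem fdivq_add_mul {m : ℕ} (hm : 0 < m) (x q : ℤ) :
    fdivq m (x + m * q) = fdivq m x + q := by
  rw [fdivq_eq_ediv, fdivq_eq_ediv, Int.add_mul_ediv_left _ _ (by positivity)]

theorem fdivq_eq_fdivq_sub_one_iff {m : ℕ} (hm : 0 < m) (x : ℤ) :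
    fdivq m x = fdivq m (x - 1) ↔ ¬ (m : ℤ) ∣ x := by
  have hm' : (0 : ℤ) < m := by exact_mod_cast hm
  rw [fdivq_eq_ediv, fdivq_eq_ediv]
  constructor
  · rintro h ⟨q, rfl⟩
    rw [Int.mul_ediv_cancel_left _ hm'.ne'] at h
    have := Int.lt_mul_ediv_self_add (x := m * q - 1) hm'
    rw [← h] at this
    have := Int.mul_ediv_self_le (x := m * q - 1) hm'.ne'
    rw [← h] at this
    omega
  · intro h
    have h1 := Int.emod_nonneg x hm'.ne'
    have h2 := Int.emod_lt_of_pos x hm'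
    have h3 : x % m ≠ 0 := fun h0 => h (Int.dvd_of_emod_eq_zero h0)
    have h4 := Int.mul_ediv_add_emod x m
    symm
    rw [Int.ediv_eq_iff_of_pos hm']
    constructor <;> nlinarith [h1.lt_of_ne' h3]

theorem gapSum_add_mul {m r n : ℕ} (hm : 0 < m) {lam : Fin (r + 1) → ℤ}
    (hsum : ∑ i, lam i = 0) {c : Fin n → Fin (r + 1)} (hc : Function.Injective c)
    (a : Fin n → ℤ) (t q : ℤ) :
    gapSum m r n lam c a (t + m * q) = gapSum m r n lam c a t := by
  have h₁ : ∀ i, fdivq m (a i + (t + m * q) * lam (c i)) =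
      fdivq m (a i + t * lam (c i)) + q * lam (c i) := fun i => by
    rw [← fdivq_add_mul hm]; congr 1; ring
  have h₂ : ∀ w, fdivq m ((t + m * q) * lam w) = fdivq m (t * lam w) + q * lam w := fun w => by
    rw [← fdivq_add_mul hm]; congr 1; ring
  have h₃ : ∑ i, lam (c i) + ∑ w ∈ univ \ image c univ, lam w = 0 := by
    rw [← Finset.sum_image (f := lam) (g := c) (fun _ _ _ _ h => hc h), add_comm,
      Finset.sum_sdiff (subset_univ _), hsum]
  simp only [gapSum, h₁, h₂, Finset.sum_add_distrib, ← Finset.mul_sum]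
  linear_combination q * h₃

theorem isArithPureGap_iff {m r n : ℕ} (hm : 0 < m) {lam : Fin (r + 1) → ℤ}
    (hsum : ∑ i, lam i = 0) {c : Fin n → Fin (r + 1)} (hc : Function.Injective c)
    (a : Fin n → ℤ) :
    IsArithPureGap m r n lam c a ↔ (∀ i, 0 ≤ a i) ∧
      ∀ t : ℤ, gapSum m r n lam c a t < 0 ∨ ∀ i, ¬ (m : ℤ) ∣ a i + t * lam (c i) := by
  have hm' : (0 : ℤ) < m := by exact_mod_cast hm
  simp only [IsArithPureGap, fdivq_eq_fdivq_sub_one_iff hm]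
  refine and_congr_right fun _ => ⟨fun h t => ?_, fun h t _ _ => ?_⟩
  · have ht := h (t % m) (Int.emod_nonneg t hm'.ne')
      (Int.le_sub_one_of_lt (Int.emod_lt_of_pos t hm'))
    rw [← gapSum_add_mul hm hsum hc a (t % m) (t / m), Int.emod_add_mul_ediv] at ht
    refine (ht.imp And.left fun h => h.1.2).imp_right fun h i hi => h i ?_
    have : a i + t % m * lam (c i) = a i + t * lam (c i) - m * (t / m * lam (c i)) := by
      rw [Int.emod_def]; ring
    rw [this]
    exact dvd_sub hi (dvd_mul_right _ _)
  · rcases h t with h | h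
    · exact Or.inl ⟨h, fun h' => by omega⟩
    · by_cases h0 : gapSum m r n lam c a t < 0
      · exact Or.inl ⟨h0, fun h' => by omega⟩
      · exact Or.inr ⟨⟨by omega, h⟩, h0⟩

theorem gapSum_snoc (m r n : ℕ) (lam : Fin (r + 1) → ℤ) (c : Fin (n + 1) → Fin (r + 1))
    (a₀ : Fin n → ℤ) (a t : ℤ) :
    gapSum m r (n + 1) lam c (Fin.snoc a₀ a) t =
      (∑ i : Fin n, fdivq m (a₀ i + t * lam (c i.castSucc))) +
        fdivq m (a + t * lam (c (Fin.last n))) +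
        ∑ w ∈ univ \ image c univ, fdivq m (t * lam w) := by
  simp [gapSum, Fin.sum_univ_castSucc]

theorem gapSum_snoc_eq_add_sub (m r n : ℕ) (lam : Fin (r + 1) → ℤ)
    {c : Fin (n + 1) → Fin (r + 1)} (hc : Function.Injective c) (a₀ : Fin n → ℤ) (a t : ℤ) :
    gapSum m r (n + 1) lam c (Fin.snoc a₀ a) t =
      gapSum m r n lam (fun i => c i.castSucc) a₀ t +
        fdivq m (a + t * lam (c (Fin.last n))) - fdivq m (t * lam (c (Fin.last n))) := by
  have h : univ \ image (fun i : Fin n => c i.castSucc) univ =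
      insert (c (Fin.last n)) (univ \ image c univ) := by
    ext w
    simp only [mem_sdiff, mem_univ, true_and, mem_image, mem_insert, Fin.exists_fin_succ',
      not_or, not_exists]
    refine ⟨fun h => ?_, ?_⟩
    · by_cases hw : w = c (Fin.last n)
      · exact Or.inl hw
      · exact Or.inr ⟨h, Ne.symm hw⟩
    · rintro (rfl | h) i
      · exact fun h => (Fin.castSucc_lt_last i).ne (hc h)
      · exact h.1 i
  rw [gapSum_snoc, gapSum, h, Finset.sum_insert (by simp)]
  ring

/-- Extending a bottom pure gap at `s` places by a last coordinate `a`: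
criterion in terms of the inequalities for `1 ≤ k ≤ a−1`. -/
theorem snoc_pureGap_iff (m r : ℕ) (hm : 2 ≤ m) (hr : 1 ≤ r)
    (lam : Fin (r + 1) → ℤ) (hlam : ∀ i, lam i ≠ 0) (hsum : ∑ i, lam i = 0)
    (s : ℕ) (hs1 : 1 ≤ s) (hsr : s ≤ r) (perm : Equiv.Perm (Fin (r + 1)))
    (c : Fin (s + 1) → Fin (r + 1))
    (hc : ∀ i, c i = perm (Fin.castLE (Nat.succ_le_succ hsr) i))
    (cs : Fin s → Fin (r + 1)) (hcs : ∀ i, cs i = c i.castSucc)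
    (hgcd : ∀ i, Int.gcd (m : ℤ) (lam (c i)) = 1)
    (lam' : ℤ) (hinv : Int.ModEq (m : ℤ) (lam' * lam (c (Fin.last s))) 1)
    (a₀ : Fin s → ℤ)
    (hpure : IsArithPureGap m r s lam cs a₀)
    (hbot : ∀ i, 1 ≤ a₀ i ∧ a₀ i ≤ (m : ℤ) - 1)
    (a : ℤ) (ha1 : 1 ≤ a) (ha2 : a ≤ (m : ℤ) - 1)
    (hineq : (∑ i : Fin s, fdivq m (a₀ i - a * lam' * lam (cs i))) +
        fdivq m (a - a * lam' * lam (c (Fin.last s))) +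
        (∑ w ∈ Finset.univ \ Finset.image c Finset.univ,
          fdivq m (-(a * lam') * lam w)) ≤ -1) :
    IsArithPureGap m r (s + 1) lam c (Fin.snoc a₀ a) ↔
      ∀ k : ℤ, 1 ≤ k → k ≤ a - 1 →
        ((∑ i : Fin s, fdivq m (a₀ i - k * lam' * lam (cs i))) +
            fdivq m (a - k * lam' * lam (c (Fin.last s))) +
            (∑ w ∈ Finset.univ \ Finset.image c Finset.univ,
              fdivq m (-(k * lam') * lam w)) ≤ -1) ∨
        (∀ i : Fin s, ¬ Int.ModEq (m : ℤ) (a₀ i) (k * lam' * lam (cs i))) := by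
  have hm0 : 0 < m := by omega
  have hm' : (0 : ℤ) < m := by exact_mod_cast hm0
  obtain rfl : cs = fun i => c i.castSucc := funext hcs
  have hinj : Function.Injective c := fun i j h => by
    rw [hc, hc] at h
    exact Fin.castLE_injective _ (perm.injective h)
  have hinj' : Function.Injective fun i : Fin s => c i.castSucc :=
    hinj.comp (Fin.castSucc_injective s)
  have hrw : ∀ k : ℤ, (∑ i : Fin s, fdivq m (a₀ i - k * lam' * lam (c i.castSucc))) +
        fdivq m (a - k * lam' * lam (c (Fin.last s))) +
        (∑ w ∈ univ \ image c univ, fdivq m (-(k * lam') * lam w)) =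
      gapSum m r (s + 1) lam c (Fin.snoc a₀ a) (-(k * lam')) := fun k => by
    simp only [gapSum_snoc, neg_mul, sub_eq_add_neg]
  have hmod : ∀ k i, Int.ModEq (m : ℤ) (a₀ i) (k * lam' * lam (c (Fin.castSucc i))) ↔
      (m : ℤ) ∣ a₀ i + -(k * lam') * lam (c i.castSucc) := fun k i => by
    rw [Int.modEq_comm, Int.modEq_iff_dvd, neg_mul, ← sub_eq_add_neg]
  simp only [hrw, hmod] at hineq ⊢
  rw [isArithPureGap_iff hm0 hsum hinj'] at hpure
  rw [isArithPureGap_iff hm0 hsum hinj]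
  simp only [Fin.forall_fin_succ', Fin.snoc_castSucc, Fin.snoc_last]
  obtain ⟨p, hp⟩ := hinv.symm.dvd
  constructor
  · rintro ⟨-, h⟩ k - -
    exact (h (-(k * lam'))).imp (fun h => by omega) And.left
  · refine fun h => ⟨⟨hpure.1, by omega⟩, fun t => ?_⟩
    set l := lam (c (Fin.last s)) with hl
    set k := -(t * l) % m with hk
    have hk0 : 0 ≤ k := Int.emod_nonneg _ hm'.ne'
    have hkm : k < m := Int.emod_lt_of_pos _ hm'
    obtain ⟨q, hq⟩ : ∃ q, t * l = -k + m * q :=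
      ⟨-(-(t * l) / m), by linear_combination Int.mul_ediv_add_emod (-(t * l)) m⟩
    obtain ⟨u, hu⟩ : ∃ u, -(k * lam') = t + m * u :=
      ⟨t * p - q * lam', by linear_combination t * hp - lam' * hq⟩
    have hgap : gapSum m r (s + 1) lam c (Fin.snoc a₀ a) (-(k * lam')) =
        gapSum m r (s + 1) lam c (Fin.snoc a₀ a) t := by
      rw [hu, gapSum_add_mul hm0 hsum hinj]
    have hlast : (m : ℤ) ∣ a + t * l ↔ k = a := by
      have : a + t * l = a - k + m * q := by rw [hq]; ring
      rw [this, dvd_add_left (dvd_mul_right _ _)]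
      refine ⟨fun hd => ?_, fun h => by simp [h]⟩
      have := Int.eq_zero_of_abs_lt_dvd hd (by rw [abs_lt]; omega)
      omega
    by_cases hka : k = a
    · rw [hka] at hgap
      exact Or.inl (by omega)
    rw [hlast]
    by_cases hk1 : 1 ≤ k ∧ k ≤ a - 1
    · refine (h k hk1.1 hk1.2).imp (fun h => by omega) fun h => ⟨fun i hi => h i ?_, hka⟩
      rw [hu, add_mul, ← add_assoc, mul_assoc]
      exact dvd_add hi (dvd_mul_right _ _)
    · refine (hpure.2 t).imp (fun h => ?_) fun h => ⟨h, hka⟩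
      have hfl : fdivq m (a + t * l) = fdivq m (t * l) := by
        rw [hq, ← add_assoc, fdivq_add_mul hm0, fdivq_add_mul hm0, fdivq_eq_ediv, fdivq_eq_ediv]
        rcases hk0.eq_or_lt with h0 | h0
        · rw [← h0, neg_zero, add_zero, Int.ediv_eq_zero_of_lt (by omega) (by omega), Int.zero_ediv]
        · rw [(Int.ediv_eq_iff_of_pos hm').2 (by omega : -1 * (m : ℤ) ≤ a + -k ∧ _),
            (Int.ediv_eq_iff_of_pos hm').2 (by omega : -1 * (m : ℤ) ≤ -k ∧ _)]
      rw [gapSum_snoc_eq_add_sub m r s lam hinj, ← hl, hfl]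
      omega
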